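/- Fix ε > 0 and define v(x,t) := −(3/(2πi)) ∫_{−∞}^{∞} e^{i(ξ+iε)x + i(ξ+iε)³ t} (ξ+iε)^{−1} dξ for (x,t) ∈ Q (the integral is absolutely convergent for t > 0 and is independent of ε > 0). Then v is smooth on Q, satisfies the linearized Korteweg–de Vries equation v_t = −v_{xxx} at every point of Q, and satisfies lim_{x→0⁺} v(x,t) = 1 for every t > 0 and lim_{t→0⁺} v(x,t) = 0 for every x > 0. -/

import Mathlib

open MeasureTheory Filter Set Topology

/-- The point `λ = ξ + iε` on the line `Im λ = ε`. -/
noncomputable def lamC (ε ξ : ℝ) : ℂ := (ξ:ℂ) + Complex.I * (ε:ℂ)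

/-- `v(x,t) = −(3/(2πi)) ∫_{Im λ = ε} e^{iλx + iλ³t} λ^{−1} dλ`. -/
noncomputable def kdvVeps (ε x t : ℝ) : ℂ :=
  -(3 / (2 * (Real.pi : ℂ) * Complex.I)) *
    ∫ ξ : ℝ, Complex.exp (Complex.I * lamC ε ξ * (x:ℂ) + Complex.I * (lamC ε ξ)^3 * (t:ℂ))
      / lamC ε ξ

open scoped Nat

/-- weighted integrand -/
noncomputable def kdvPhi (ε : ℝ) (k : ℕ) (x t ξ : ℝ) : ℂ :=
  lamC ε ξ ^ k * (Complex.exp (Complex.I * lamC ε ξ * (x:ℂ) + Complex.I * (lamC ε ξ)^3 * (t:ℂ))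
      / lamC ε ξ)

lemma lamC_im (ε ξ : ℝ) : (lamC ε ξ).im = ε := by simp [lamC]
lemma lamC_re (ε ξ : ℝ) : (lamC ε ξ).re = ξ := by simp [lamC]

lemma lamC_norm_ge {ε : ℝ} (hε : 0 < ε) (ξ : ℝ) : ε ≤ ‖lamC ε ξ‖ := by
  have := Complex.abs_im_le_norm (lamC ε ξ)
  rw [lamC_im, abs_of_pos hε] at this
  exact this

lemma lamC_ne {ε : ℝ} (hε : 0 < ε) (ξ : ℝ) : lamC ε ξ ≠ 0 := by
  intro h
  have := lamC_norm_ge hε ξ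
  rw [h, norm_zero] at this
  linarith

lemma lamC_norm_le {ε : ℝ} (hε : 0 < ε) (ξ : ℝ) : ‖lamC ε ξ‖ ≤ |ξ| + ε := by
  have := Complex.norm_le_abs_re_add_abs_im (lamC ε ξ)
  rwa [lamC_im, lamC_re, abs_of_pos hε] at this

lemma kdv_exp_norm (ε x t ξ : ℝ) :
    ‖Complex.exp (Complex.I * lamC ε ξ * (x:ℂ) + Complex.I * (lamC ε ξ)^3 * (t:ℂ))‖
      = Real.exp (-ε * x + t * (ε^3 - 3 * ξ^2 * ε)) := by
  rw [Complex.norm_exp]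
  congr 1
  simp [lamC, pow_succ]
  ring

lemma kdvPhi_bound {ε : ℝ} (hε : 0 < ε) (k : ℕ) (X : ℝ) {a : ℝ} (ha : 0 < a) (T : ℝ) :
    ∃ C, ∀ x t ξ : ℝ, |x| ≤ X → a ≤ t → t ≤ T →
      ‖kdvPhi ε k x t ξ‖ ≤ C * Real.exp (-(3 * ε * a / 2) * ξ^2) := by
  set b := 3 * ε * a / 2 with hb
  have hb0 : 0 < b := by positivity
  refine ⟨k ! * Real.exp (ε + 1/(4*b) + ε * X + ε^3*T) / ε, fun x t ξ hx hat htT => ?_⟩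
  have h1 : ‖lamC ε ξ‖ ^ k ≤ k ! * Real.exp (|ξ| + ε) := by
    have h := Real.pow_div_factorial_le_exp (|ξ| + ε) (by positivity) k
    rw [div_le_iff₀ (by positivity), mul_comm] at h
    exact (pow_le_pow_left₀ (norm_nonneg _) (lamC_norm_le hε ξ) k).trans h
  have h2 : |ξ| ≤ b * ξ^2 + 1/(4*b) := by
    have : b * ξ^2 + 1/(4*b) - |ξ| = b * (|ξ| - 1/(2*b))^2 := by
      rw [← sq_abs ξ]; field_simp; ring
    have h3 : 0 ≤ b * (|ξ| - 1/(2*b))^2 := by positivity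
    linarith
  rw [kdvPhi, norm_mul, norm_div, norm_pow, kdv_exp_norm]
  have h4 : -ε * x + t * (ε^3 - 3 * ξ^2 * ε) ≤ ε * X + ε^3 * T - 2 * b * ξ^2 := by
    have e1 : -ε * x ≤ ε * X := by nlinarith [neg_abs_le x]
    have e2 : t * ε^3 ≤ ε^3 * T := by
      have := pow_pos hε 3
      nlinarith
    have e3 : a * (3 * ξ^2 * ε) ≤ t * (3 * ξ^2 * ε) := by gcongr
    have e4 : 2 * b * ξ^2 = a * (3 * ξ^2 * ε) := by rw [hb]; ring
    linarith
  calc ‖lamC ε ξ‖ ^ k * (Real.exp (-ε * x + t * (ε^3 - 3 * ξ^2 * ε)) / ‖lamC ε ξ‖)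
      ≤ (k ! * Real.exp (b * ξ^2 + 1/(4*b) + ε)) *
          (Real.exp (ε * X + ε^3 * T - 2 * b * ξ^2) / ε) := by
        gcongr
        · exact h1.trans (by gcongr)
        · exact lamC_norm_ge hε ξ
    _ = _ := by
        have : Real.exp (b * ξ^2 + 1/(4*b) + ε) * Real.exp (ε * X + ε^3 * T - 2 * b * ξ^2) =
          Real.exp (ε + 1/(4*b) + ε * X + ε^3*T) * Real.exp (-b * ξ^2) := by
          rw [← Real.exp_add, ← Real.exp_add]; congr 1; ring
        linear_combination (k ! / ε : ℝ) * this

lemma lamC_cont (ε : ℝ) : Continuous (lamC ε) := by unfold lamC; fun_prop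

lemma kdvPhi_cont {ε : ℝ} (hε : 0 < ε) (k : ℕ) (x t : ℝ) : Continuous (kdvPhi ε k x t) := by
  unfold kdvPhi
  have := lamC_cont ε
  exact (this.pow k).mul (Continuous.div (by fun_prop) this (lamC_ne hε))

lemma kdvPhi_int {ε : ℝ} (hε : 0 < ε) (k : ℕ) (x : ℝ) {t : ℝ} (ht : 0 < t) :
    Integrable (kdvPhi ε k x t) := by
  obtain ⟨C, hC⟩ := kdvPhi_bound hε k |x| ht t
  refine Integrable.mono' ((integrable_exp_neg_mul_sq (b := 3 * ε * t / 2)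
    (by positivity)).const_mul C) (kdvPhi_cont hε k x t).aestronglyMeasurable ?_
  exact Eventually.of_forall fun ξ => hC x t ξ le_rfl le_rfl le_rfl

noncomputable def kdvL1 : ℝ × ℝ →L[ℝ] ℂ := Complex.ofRealCLM.comp (ContinuousLinearMap.fst ℝ ℝ ℝ)
noncomputable def kdvL2 : ℝ × ℝ →L[ℝ] ℂ := Complex.ofRealCLM.comp (ContinuousLinearMap.snd ℝ ℝ ℝ)

noncomputable def kdvG (ε : ℝ) (k : ℕ) (p : ℝ × ℝ) : ℂ := ∫ ξ, kdvPhi ε k p.1 p.2 ξ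

lemma kdvPhi_hasFDerivAt {ε : ℝ} (hε : 0 < ε) (k : ℕ) (ξ : ℝ) (p : ℝ × ℝ) :
    HasFDerivAt (fun p : ℝ × ℝ => kdvPhi ε k p.1 p.2 ξ)
      (kdvPhi ε (k+1) p.1 p.2 ξ • (Complex.I • kdvL1)
        + kdvPhi ε (k+3) p.1 p.2 ξ • (Complex.I • kdvL2)) p := by
  have h1 : HasFDerivAt (fun p : ℝ × ℝ => ((p.1 : ℝ) : ℂ)) kdvL1 p := kdvL1.hasFDerivAt
  have h2 : HasFDerivAt (fun p : ℝ × ℝ => ((p.2 : ℝ) : ℂ)) kdvL2 p := kdvL2.hasFDerivAt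
  have h3 := (((h1.const_mul (Complex.I * lamC ε ξ)).add
    (h2.const_mul (Complex.I * lamC ε ξ ^ 3))).cexp.const_mul (lamC ε ξ ^ k / lamC ε ξ))
  have hf : (fun p : ℝ × ℝ => kdvPhi ε k p.1 p.2 ξ) = (fun p : ℝ × ℝ =>
      lamC ε ξ ^ k / lamC ε ξ * Complex.exp (((fun y : ℝ × ℝ => Complex.I * lamC ε ξ * (y.1:ℂ)) +
        fun y : ℝ × ℝ => Complex.I * lamC ε ξ ^ 3 * (y.2:ℂ)) p)) := by
    funext p; simp only [kdvPhi, Pi.add_apply]; ring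
  rw [hf]
  refine h3.congr_fderiv ?_
  refine ContinuousLinearMap.ext fun q => ?_
  simp only [kdvPhi, _root_.add_apply, _root_.smul_apply, smul_eq_mul,
    Pi.add_apply]
  ring

lemma kdvG_hasFDerivAt {ε : ℝ} (hε : 0 < ε) (k : ℕ) (p : ℝ × ℝ) (hp : 0 < p.2) :
    HasFDerivAt (kdvG ε k)
      (kdvG ε (k+1) p • (Complex.I • kdvL1) + kdvG ε (k+3) p • (Complex.I • kdvL2)) p := by
  obtain ⟨C1, hC1⟩ := kdvPhi_bound hε (k+1) (|p.1| + 1) (half_pos hp) (p.2 + 1)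
  obtain ⟨C2, hC2⟩ := kdvPhi_bound hε (k+3) (|p.1| + 1) (half_pos hp) (p.2 + 1)
  set b := 3 * ε * (p.2/2) / 2 with hb
  have hb0 : 0 < b := by positivity
  have hg := integrable_exp_neg_mul_sq hb0
  let S : Set (ℝ × ℝ) := {q | |q.1| < |p.1| + 1 ∧ p.2/2 < q.2 ∧ q.2 < p.2 + 1}
  have hS : S ∈ 𝓝 p := by
    refine IsOpen.mem_nhds ?_ (show _ ∧ _ ∧ _ from ⟨by linarith, by linarith, by linarith⟩)
    have o1 : IsOpen {q : ℝ × ℝ | |q.1| < |p.1| + 1} := isOpen_lt (by fun_prop) (by fun_prop)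
    have o2 : IsOpen {q : ℝ × ℝ | p.2/2 < q.2} := isOpen_lt (by fun_prop) (by fun_prop)
    have o3 : IsOpen {q : ℝ × ℝ | q.2 < p.2 + 1} := isOpen_lt (by fun_prop) (by fun_prop)
    exact o1.inter (o2.inter o3)
  have i1 := kdvPhi_int hε (k+1) p.1 hp
  have i2 := kdvPhi_int hε (k+3) p.1 hp
  have key := hasFDerivAt_integral_of_dominated_of_fderiv_le (𝕜 := ℝ) (μ := volume)
    (F := fun (p : ℝ × ℝ) ξ => kdvPhi ε k p.1 p.2 ξ)
    (F' := fun p ξ => kdvPhi ε (k+1) p.1 p.2 ξ • (Complex.I • kdvL1)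
        + kdvPhi ε (k+3) p.1 p.2 ξ • (Complex.I • kdvL2))
    (bound := fun ξ => (C1 * Real.exp (-b * ξ^2)) * ‖Complex.I • kdvL1‖
      + (C2 * Real.exp (-b * ξ^2)) * ‖Complex.I • kdvL2‖)
    hS (Eventually.of_forall fun q => (kdvPhi_cont hε k q.1 q.2).aestronglyMeasurable)
    (kdvPhi_int hε k p.1 hp)
    (((kdvPhi_cont hε (k+1) p.1 p.2).smul continuous_const).add
      ((kdvPhi_cont hε (k+3) p.1 p.2).smul continuous_const)).aestronglyMeasurable
    (Eventually.of_forall fun ξ q hq => ?_)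
    (((hg.const_mul C1).mul_const _).add ((hg.const_mul C2).mul_const _))
    (Eventually.of_forall fun ξ q hq => kdvPhi_hasFDerivAt hε k ξ q)
  · rw [integral_add (i1.smul_const _) (i2.smul_const _), integral_smul_const,
      integral_smul_const] at key
    exact key
  · refine (norm_add_le _ _).trans ?_
    rw [norm_smul _ (Complex.I • kdvL1), norm_smul _ (Complex.I • kdvL2)]
    gcongr
    · exact hC1 _ _ _ hq.1.le hq.2.1.le hq.2.2.le
    · exact hC2 _ _ _ hq.1.le hq.2.1.le hq.2.2.le

lemma kdvG_contDiffOn {ε : ℝ} (hε : 0 < ε) (n : ℕ) : ∀ k,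
    ContDiffOn ℝ n (kdvG ε k) {p : ℝ × ℝ | 0 < p.2} := by
  have hO : IsOpen {p : ℝ × ℝ | 0 < p.2} := isOpen_lt (by fun_prop) (by fun_prop)
  induction n with
  | zero =>
    intro k
    simp only [Nat.cast_zero, contDiffOn_zero]
    exact fun p hp => (kdvG_hasFDerivAt hε k p hp).continuousAt.continuousWithinAt
  | succ n ih =>
    intro k
    push_cast
    rw [contDiffOn_succ_iff_hasFDerivWithinAt_of_uniqueDiffOn hO.uniqueDiffOn]
    refine ⟨by simp, _, ?_, fun p hp => (kdvG_hasFDerivAt hε k p hp).hasFDerivWithinAt⟩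
    exact ((ih (k+1)).smul contDiffOn_const).add ((ih (k+3)).smul contDiffOn_const)

lemma kdvG_dx {ε : ℝ} (hε : 0 < ε) (k : ℕ) (x : ℝ) {t : ℝ} (ht : 0 < t) :
    HasDerivAt (fun y => kdvG ε k (y, t)) (Complex.I * kdvG ε (k+1) (x,t)) x := by
  have h := (kdvG_hasFDerivAt hε k (x,t) ht).comp_hasDerivAt x
    ((hasDerivAt_id x).prodMk (hasDerivAt_const x t))
  refine h.congr_deriv ?_
  simp [kdvL1, kdvL2]; ring

lemma kdvG_dt {ε : ℝ} (hε : 0 < ε) (k : ℕ) (x : ℝ) {t : ℝ} (ht : 0 < t) :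
    HasDerivAt (fun s => kdvG ε k (x, s)) (Complex.I * kdvG ε (k+3) (x,t)) t := by
  have h := (kdvG_hasFDerivAt hε k (x,t) ht).comp_hasDerivAt t
    ((hasDerivAt_const t x).prodMk (hasDerivAt_id t))
  refine h.congr_deriv ?_
  simp [kdvL1, kdvL2]; ring

lemma kdvVeps_eq (ε x t : ℝ) :
    kdvVeps ε x t = -(3 / (2 * (Real.pi : ℂ) * Complex.I)) * kdvG ε 0 (x,t) := by
  simp [kdvVeps, kdvG, kdvPhi]

lemma kdv_pde {ε : ℝ} (hε : 0 < ε) (x : ℝ) {t : ℝ} (ht : 0 < t) :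
    deriv (fun s => kdvVeps ε x s) t = -(iteratedDeriv 3 (fun y => kdvVeps ε y t) x) := by
  simp only [kdvVeps_eq]
  set c := -(3 / (2 * (Real.pi : ℂ) * Complex.I))
  rw [((kdvG_dt hε 0 x ht).const_mul c).deriv]
  have h : ∀ (k : ℕ) (d : ℂ), deriv (fun y => d * kdvG ε k (y,t))
      = fun y => (d * Complex.I) * kdvG ε (k+1) (y,t) := by
    intro k d; funext y
    rw [((kdvG_dx hε k y ht).const_mul d).deriv]; ring
  rw [iteratedDeriv_succ, iteratedDeriv_succ, iteratedDeriv_one, h, h, h]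
  simp only [zero_add, Nat.reduceAdd]
  linear_combination (c * Complex.I * kdvG ε 3 (x,t)) * Complex.I_sq

noncomputable def kdvF (x t : ℝ) (l : ℂ) : ℂ :=
  Complex.exp (Complex.I * l * (x:ℂ) + Complex.I * l^3 * (t:ℂ)) / l

lemma lamC_eq (ε ξ : ℝ) : lamC ε ξ = (ξ:ℂ) + (ε:ℂ) * Complex.I := by simp [lamC, mul_comm]

lemma kdvPhi_zero (ε x t ξ : ℝ) : kdvPhi ε 0 x t ξ = kdvF x t ((ξ:ℂ) + (ε:ℂ) * Complex.I) := by
  rw [← lamC_eq]; simp [kdvPhi, kdvF]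

lemma kdvF_norm (x t ξ y : ℝ) : ‖kdvF x t ((ξ:ℂ) + (y:ℂ) * Complex.I)‖ =
    Real.exp (-y * x + t * (y^3 - 3 * ξ^2 * y)) / ‖lamC y ξ‖ := by
  rw [← lamC_eq, kdvF, norm_div, kdv_exp_norm]

lemma kdvF_vert {x t a b : ℝ} (hx : 0 < x) (ht : 0 < t) (ha : 0 < a) (hab : a ≤ b) (ξ : ℝ) :
    ‖∫ y : ℝ in a..b, kdvF x t ((ξ:ℂ) + (y:ℂ) * Complex.I)‖ ≤
      Real.exp (t * b^3 - (3 * a * t) * ξ^2) / a * (b - a) := by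
  have h := intervalIntegral.norm_integral_le_of_norm_le_const (a := a) (b := b)
    (f := fun y : ℝ => kdvF x t ((ξ:ℂ) + (y:ℂ) * Complex.I))
    (C := Real.exp (t * b^3 - (3 * a * t) * ξ^2) / a) ?_
  · rwa [abs_of_nonneg (by linarith)] at h
  · intro y hy
    rw [uIoc_of_le hab] at hy
    have hy0 : 0 < y := ha.trans hy.1
    rw [kdvF_norm]
    gcongr
    · have e1 : 0 ≤ y * x := by positivity
      have e2 : y^3 ≤ b^3 := by gcongr; exact hy.2
      have e3 : 3 * a * t * ξ^2 ≤ 3 * y * t * ξ^2 := by gcongr; exact hy.1.le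
      nlinarith
    · exact hy.1.le.trans (lamC_norm_ge hy0 ξ)

lemma kdvG_shift {x t a b : ℝ} (hx : 0 < x) (ht : 0 < t) (ha : 0 < a) (hab : a ≤ b) :
    kdvG a 0 (x,t) = kdvG b 0 (x,t) := by
  have hb : 0 < b := ha.trans_le hab
  have l1 := intervalIntegral_tendsto_integral (kdvPhi_int ha 0 x ht) tendsto_neg_atTop_atBot
    tendsto_id
  have l2 := intervalIntegral_tendsto_integral (kdvPhi_int hb 0 x ht) tendsto_neg_atTop_atBot
    tendsto_id
  have l3 := l1.sub l2
  have hrect : ∀ R : ℝ, ‖(∫ ξ in -R..R, kdvPhi a 0 x t ξ) - ∫ ξ in -R..R, kdvPhi b 0 x t ξ‖ ≤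
      2 * (Real.exp (t * b^3 - (3 * a * t) * R^2) / a * (b - a)) := by
    intro R
    have h := Complex.integral_boundary_rect_eq_zero_of_differentiableOn (kdvF x t)
      (⟨-R, a⟩ : ℂ) (⟨R, b⟩ : ℂ) ?_
    · simp only [← kdvPhi_zero] at h
      have h1 := kdvF_vert hx ht ha hab R
      have h2 := kdvF_vert hx ht ha hab (-R)
      rw [neg_sq] at h2
      simp only [smul_eq_mul] at h
      have h3 : (∫ ξ in -R..R, kdvPhi a 0 x t ξ) - ∫ ξ in -R..R, kdvPhi b 0 x t ξ =
        Complex.I * (∫ y : ℝ in a..b, kdvF x t (((-R:ℝ):ℂ) + (y:ℂ) * Complex.I)) -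
        Complex.I * (∫ y : ℝ in a..b, kdvF x t ((R:ℂ) + (y:ℂ) * Complex.I)) := by
        simp only [← kdvPhi_zero]
        linear_combination h
      rw [h3]
      refine (norm_sub_le _ _).trans ?_
      rw [norm_mul, norm_mul, Complex.norm_I]
      linarith
    · intro l hl
      have him : a ≤ l.im := by
        have := hl.2
        simp only [mem_preimage, uIcc_of_le hab] at this
        exact this.1
      have hl0 : l ≠ 0 := by
        rintro rfl
        simp at him; linarith
      apply DifferentiableAt.differentiableWithinAt
      unfold kdvF
      fun_prop (disch := assumption)
  have hz : Tendsto (fun R : ℝ => 2 * (Real.exp (t * b^3 - (3 * a * t) * R^2) / a * (b - a)))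
      atTop (𝓝 0) := by
    have : Tendsto (fun R : ℝ => Real.exp (t * b^3 - (3 * a * t) * R^2)) atTop (𝓝 0) := by
      refine Real.tendsto_exp_atBot.comp ?_
      have : Tendsto (fun R : ℝ => (3 * a * t) * R^2) atTop atTop :=
        (tendsto_pow_atTop two_ne_zero).const_mul_atTop (by positivity)
      simpa [sub_eq_add_neg] using tendsto_atBot_add_const_left _ (t * b^3)
        (tendsto_neg_atTop_atBot.comp this)
    simpa using ((this.div_const a).mul_const (b - a)).const_mul 2
  have l4 := squeeze_zero_norm hrect hz
  exact sub_eq_zero.1 (tendsto_nhds_unique l3 l4)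

lemma kdvG_norm_le {ε : ℝ} (hε : 0 < ε) (x : ℝ) {t : ℝ} (ht : 0 < t) :
    ‖kdvG ε 0 (x,t)‖ ≤ Real.exp (-ε * x + t * ε^3) / ε * √(Real.pi / (3 * ε * t)) := by
  have hg := integrable_exp_neg_mul_sq (b := 3 * ε * t) (by positivity)
  rw [← integral_gaussian, ← integral_const_mul]
  refine norm_integral_le_of_norm_le (hg.const_mul _) (Eventually.of_forall fun ξ => ?_)
  rw [kdvPhi_zero, kdvF_norm]
  have : Real.exp (-ε * x + t * ε^3) / ε * Real.exp (-(3 * ε * t) * ξ^2) =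
      Real.exp (-ε * x + t * (ε^3 - 3 * ξ^2 * ε)) / ε := by
    rw [div_mul_eq_mul_div, ← Real.exp_add]; congr 2; ring
  rw [this]
  gcongr
  exact lamC_norm_ge hε ξ

lemma kdvG_t_lim {ε : ℝ} (hε : 0 < ε) {x : ℝ} (hx : 0 < x) :
    Tendsto (fun t => kdvG ε 0 (x,t)) (𝓝[>] (0:ℝ)) (𝓝 0) := by
  have hd : Tendsto (fun t : ℝ => t ^ (-(1/3) : ℝ)) (𝓝[>] (0:ℝ)) atTop :=
    tendsto_rpow_neg_nhdsGT_zero (by norm_num)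
  have hz : Tendsto (fun t : ℝ => Real.exp (1 - x * t ^ (-(1/3) : ℝ)) * √(Real.pi / 3))
      (𝓝[>] (0:ℝ)) (𝓝 0) := by
    have : Tendsto (fun t : ℝ => Real.exp (1 - x * t ^ (-(1/3) : ℝ))) (𝓝[>] (0:ℝ)) (𝓝 0) := by
      refine Real.tendsto_exp_atBot.comp ?_
      have := tendsto_atBot_add_const_left _ (1:ℝ)
        (tendsto_neg_atTop_atBot.comp (hd.const_mul_atTop hx))
      simpa [sub_eq_add_neg] using this
    simpa using this.mul_const (√(Real.pi / 3))
  refine squeeze_zero_norm' ?_ hz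
  filter_upwards [hd.eventually_ge_atTop ε, self_mem_nhdsWithin] with t h1 h2
  have ht : 0 < t := h2
  set d := t ^ (-(1/3) : ℝ) with hd'
  have hd0 : 0 < d := Real.rpow_pos_of_pos ht _
  have hd3 : t * d^3 = 1 := by
    have : d^3 = t⁻¹ := by
      rw [hd', ← Real.rpow_natCast, ← Real.rpow_mul ht.le, ← Real.rpow_neg_one]; norm_num
    rw [this, mul_inv_cancel₀ ht.ne']
  rw [kdvG_shift hx ht hε h1]
  refine (kdvG_norm_le hd0 x ht).trans (le_of_eq ?_)
  have : Real.pi / (3 * d * t) = d^2 * (Real.pi / 3) := by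
    field_simp
    linear_combination -hd3
  rw [this, Real.sqrt_mul (by positivity), Real.sqrt_sq hd0.le, hd3]
  have : -d * x + 1 = 1 - x * d := by ring
  rw [this]
  field_simp

lemma kdv_exists_E : ∃ E : ℂ → ℂ, ∀ w, HasDerivAt E (dslope Complex.exp 0 w) w := by
  have hd : Differentiable ℂ (dslope Complex.exp 0) := by
    rw [← differentiableOn_univ, Complex.differentiableOn_dslope univ_mem]
    exact Complex.differentiable_exp.differentiableOn
  obtain ⟨E, hE⟩ := hd.isExactOn_univ
  exact ⟨E, fun w => hE w (mem_univ w)⟩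

lemma kdv_dslope {w : ℂ} (hw : w ≠ 0) : dslope Complex.exp 0 w = (Complex.exp w - 1) / w := by
  rw [dslope_of_ne _ hw, slope_def_field]; simp

lemma kdv_arg_lim {w g : ℝ → ℂ} {r : ℝ → ℝ} {u : ℂ} (hu : u ∈ Complex.slitPlane)
    (hg : Tendsto g atTop (𝓝 u)) (h : ∀ᶠ R in atTop, 0 < r R ∧ w R = (r R : ℂ) * g R) :
    Tendsto (fun R => Complex.arg (w R)) atTop (𝓝 (Complex.arg u)) := by
  refine ((Complex.continuousAt_arg hu).tendsto.comp hg).congr' ?_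
  filter_upwards [h] with R hR
  rw [hR.2, Complex.arg_real_mul _ hR.1]; rfl

lemma kdv_log_sub {w w' : ℂ} (h : ‖w‖ = ‖w'‖) :
    Complex.log w - Complex.log w' = ((w.arg : ℂ) - (w'.arg : ℂ)) * Complex.I := by
  simp only [Complex.log, h]; ring

lemma kdv_div_lim (ε : ℝ) : Tendsto (fun R : ℝ => ((ε / R : ℝ) : ℂ)) atTop (𝓝 0) := by
  have h : Tendsto (fun R : ℝ => ε / R) atTop (𝓝 0) := tendsto_const_nhds.div_atTop tendsto_id
  have := (Complex.continuous_ofReal.tendsto 0).comp h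
  rw [Complex.ofReal_zero] at this
  exact this

lemma kdv_log_lim {w w' g g' : ℝ → ℂ} {r : ℝ → ℝ} {c : ℝ} (hc : 0 < c)
    (hg : Tendsto g atTop (𝓝 ((c:ℂ) * -Complex.I)))
    (hg' : Tendsto g' atTop (𝓝 ((c:ℂ) * Complex.I)))
    (h : ∀ᶠ R in atTop, 0 < r R ∧ w R = (r R : ℂ) * g R)
    (h' : ∀ᶠ R in atTop, 0 < r R ∧ w' R = (r R : ℂ) * g' R)
    (hn : ∀ R, ‖w R‖ = ‖w' R‖) :
    Tendsto (fun R => Complex.log (w R) - Complex.log (w' R)) atTop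
      (𝓝 (-(Real.pi : ℂ) * Complex.I)) := by
  have s1 : (c:ℂ) * -Complex.I ∈ Complex.slitPlane := by
    right; simp; exact hc.ne'
  have s2 : (c:ℂ) * Complex.I ∈ Complex.slitPlane := by
    right; simp; exact hc.ne'
  have a1 := (Complex.continuous_ofReal.tendsto _).comp (kdv_arg_lim s1 hg h)
  have a2 := (Complex.continuous_ofReal.tendsto _).comp (kdv_arg_lim s2 hg' h')
  rw [Complex.arg_real_mul _ hc] at a1 a2
  rw [Complex.arg_neg_I] at a1
  rw [Complex.arg_I] at a2
  have := (a1.sub a2).mul_const Complex.I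
  have e : (((-(Real.pi / 2) : ℝ) : ℂ) - ((Real.pi / 2 : ℝ) : ℂ)) * Complex.I
    = -(Real.pi : ℂ) * Complex.I := by push_cast; ring
  rw [e] at this
  exact this.congr fun R => (kdv_log_sub (hn R)).symm

lemma lamC_neg (ε R : ℝ) : lamC ε (-R) = -(starRingEnd ℂ) (lamC ε R) := by
  simp [lamC]; ring

lemma kdv_H_bound {E : ℂ → ℂ} (hE : ∀ w, HasDerivAt E (dslope Complex.exp 0 w) w)
    {a : ℝ} (ha : 1 ≤ a) {z z' : ℂ} (hz : z.re ≤ -a) (hz' : z'.re ≤ -a) :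
    ‖(E z + Complex.log (-z)) - (E z' + Complex.log (-z'))‖ ≤ Real.exp (-a) * ‖z - z'‖ := by
  have hconv : Convex ℝ {w : ℂ | w.re ≤ -a} := convex_halfSpace_re_le _
  refine hconv.norm_image_sub_le_of_norm_hasDerivWithin_le
    (f := fun w => E w + Complex.log (-w)) (f' := fun w => Complex.exp w / w)
    (fun w hw => ?_) (fun w hw => ?_) hz' hz
  · have hw' : w.re ≤ -a := hw
    have hw0 : w ≠ 0 := by rintro rfl; simp at hw'; linarith
    have hs : -w ∈ Complex.slitPlane := by left; simp; linarith
    have h := (hE w).add ((hasDerivAt_id w).neg.clog hs)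
    refine (h.congr_deriv ?_).hasDerivWithinAt
    rw [kdv_dslope hw0]
    simp only [Pi.neg_apply, id]
    field_simp
    ring
  · have hw' : w.re ≤ -a := hw
    rw [norm_div, Complex.norm_exp]
    have h1 : 1 ≤ ‖w‖ := by
      have := Complex.abs_re_le_norm w
      rw [abs_of_nonpos (by linarith)] at this
      linarith
    calc Real.exp w.re / ‖w‖ ≤ Real.exp (-a) / 1 := by gcongr
      _ = _ := by simp

lemma kdv_z_re (ε t R : ℝ) : (Complex.I * lamC ε R ^ 3 * (t:ℂ)).re = -(t * ε * (3 * R^2 - ε^2)) := by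
  simp [lamC, pow_succ]; ring

lemma kdv_z_sub (ε t R : ℝ) :
    Complex.I * lamC ε R ^ 3 * (t:ℂ) - Complex.I * lamC ε (-R) ^ 3 * (t:ℂ)
      = ((2 * t * (R^3 - 3 * R * ε^2) : ℝ) : ℂ) * Complex.I := by
  simp only [lamC]
  push_cast
  linear_combination (6 * (t:ℂ) * R * ε^2) * Complex.I * Complex.I_sq

lemma kdvG_zero_val {ε : ℝ} (hε : 0 < ε) {t : ℝ} (ht : 0 < t) :
    kdvG ε 0 (0,t) = -(2 * (Real.pi:ℂ) * Complex.I / 3) := by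
  obtain ⟨E, hE⟩ := kdv_exists_E
  have l1 := intervalIntegral_tendsto_integral (kdvPhi_int hε 0 0 ht) tendsto_neg_atTop_atBot
    tendsto_id
  -- the primitive
  let Z : ℝ → ℂ := fun R => Complex.I * lamC ε R ^ 3 * (t:ℂ)
  have hderiv : ∀ ξ : ℝ, HasDerivAt
      (fun ξ : ℝ => Complex.log (-Complex.I * lamC ε ξ) + E (Z ξ) / 3) (kdvPhi ε 0 0 t ξ) ξ := by
    intro ξ
    have hl : HasDerivAt (lamC ε) 1 ξ := by
      unfold lamC
      exact (Complex.ofRealCLM.hasDerivAt (x := ξ)).add_const _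
    have hne := lamC_ne hε ξ
    have hzne : Z ξ ≠ 0 := by
      simp only [Z]
      exact mul_ne_zero (mul_ne_zero Complex.I_ne_zero (pow_ne_zero _ hne))
        (by exact_mod_cast ht.ne')
    have hs : -Complex.I * lamC ε ξ ∈ Complex.slitPlane := by
      left; simp [lamC]; exact hε
    have d1 := (hl.const_mul (-Complex.I)).clog_real hs
    have hZ : HasDerivAt Z (Complex.I * (3 * lamC ε ξ ^ 2) * t) ξ := by
      have := ((hl.pow 3).const_mul Complex.I).mul_const (t:ℂ)
      refine this.congr_deriv ?_
      norm_num
    have d2 := ((hE (Z ξ)).comp ξ hZ).div_const 3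
    refine (d1.add d2).congr_deriv ?_
    rw [kdv_dslope hzne]
    have hk : kdvPhi ε 0 0 t ξ = Complex.exp (Z ξ) / lamC ε ξ := by simp [kdvPhi, Z]
    rw [hk]
    have htc : (t:ℂ) ≠ 0 := by exact_mod_cast ht.ne'
    have hI := Complex.I_ne_zero
    generalize Complex.exp (Z ξ) = e
    simp only [Z]
    field_simp
    ring
  have hint : ∀ R : ℝ, (∫ ξ in -R..R, kdvPhi ε 0 0 t ξ) =
      (Complex.log (-Complex.I * lamC ε R) - Complex.log (-Complex.I * lamC ε (-R))) +
      (((E (Z R) + Complex.log (-Z R)) - (E (Z (-R)) + Complex.log (-Z (-R)))) -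
        (Complex.log (-Z R) - Complex.log (-Z (-R)))) / 3 := by
    intro R
    rw [intervalIntegral.integral_eq_sub_of_hasDerivAt (fun ξ _ => hderiv ξ)
      ((kdvPhi_cont hε 0 0 t).intervalIntegrable _ _)]
    ring
  have hnl : ∀ R, ‖lamC ε R‖ = ‖lamC ε (-R)‖ := by
    intro R; rw [lamC_neg]; simp
  have hdl := kdv_div_lim ε
  have t1 : Tendsto (fun R => Complex.log (-Complex.I * lamC ε R)
      - Complex.log (-Complex.I * lamC ε (-R))) atTop (𝓝 (-(Real.pi : ℂ) * Complex.I)) := by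
    refine kdv_log_lim (c := 1) (r := fun R => R)
      (g := fun R => -Complex.I + ((ε / R : ℝ) : ℂ)) (g' := fun R => Complex.I + ((ε / R : ℝ) : ℂ))
      one_pos ?_ ?_ ?_ ?_ ?_
    · simpa using hdl.const_add (-Complex.I)
    · simpa using hdl.const_add (Complex.I)
    · filter_upwards [eventually_gt_atTop 0] with R hR
      have hR' : (R:ℂ) ≠ 0 := by exact_mod_cast hR.ne'
      refine ⟨hR, ?_⟩
      simp only [lamC]; push_cast; field_simp; linear_combination (-(ε:ℂ)) * Complex.I_sq
    · filter_upwards [eventually_gt_atTop 0] with R hR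
      have hR' : (R:ℂ) ≠ 0 := by exact_mod_cast hR.ne'
      refine ⟨hR, ?_⟩
      simp only [lamC]; push_cast; field_simp; linear_combination (-(ε:ℂ)) * Complex.I_sq
    · intro R; simp [hnl R]
  have t2 : Tendsto (fun R => Complex.log (-Z R) - Complex.log (-Z (-R))) atTop
      (𝓝 (-(Real.pi : ℂ) * Complex.I)) := by
    refine kdv_log_lim (c := t) (r := fun R => R^3)
      (g := fun R => -(Complex.I * (1 + Complex.I * ((ε / R : ℝ) : ℂ))^3 * t))
      (g' := fun R => -(Complex.I * (-1 + Complex.I * ((ε / R : ℝ) : ℂ))^3 * t))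
      ht ?_ ?_ ?_ ?_ ?_
    · have := (((((hdl.const_mul Complex.I).const_add 1).pow 3).const_mul
        Complex.I).mul_const (t:ℂ)).neg
      convert this using 2
      ring
    · have := (((((hdl.const_mul Complex.I).const_add (-1)).pow 3).const_mul
        Complex.I).mul_const (t:ℂ)).neg
      convert this using 2
      ring
    · filter_upwards [eventually_gt_atTop 0] with R hR
      have hR' : (R:ℂ) ≠ 0 := by exact_mod_cast hR.ne'
      refine ⟨by positivity, ?_⟩
      simp only [Z, lamC]; push_cast; field_simp
    · filter_upwards [eventually_gt_atTop 0] with R hR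
      have hR' : (R:ℂ) ≠ 0 := by exact_mod_cast hR.ne'
      refine ⟨by positivity, ?_⟩
      simp only [Z, lamC]; push_cast; field_simp
    · intro R; simp [Z, hnl R]
  have t3 : Tendsto (fun R => (E (Z R) + Complex.log (-Z R)) -
      (E (Z (-R)) + Complex.log (-Z (-R)))) atTop (𝓝 0) := by
    have hz : Tendsto (fun R : ℝ => 2 * t * (R^3 * Real.exp (-R))
        + 6 * t * ε^2 * (R^1 * Real.exp (-R))) atTop (𝓝 0) := by
      have := ((Real.tendsto_pow_mul_exp_neg_atTop_nhds_zero 3).const_mul (2*t)).add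
        ((Real.tendsto_pow_mul_exp_neg_atTop_nhds_zero 1).const_mul (6 * t * ε^2))
      simpa using this
    refine squeeze_zero_norm' ?_ hz
    filter_upwards [eventually_ge_atTop 1, eventually_ge_atTop ε,
      eventually_ge_atTop (1 / (2 * t * ε))] with R hR1 hR2 hR3
    have hR : R ≤ t * ε * (3 * R^2 - ε^2) := by
      have e1 : 1 ≤ R * (2 * t * ε) := by rwa [div_le_iff₀ (by positivity)] at hR3
      have e2 : ε^2 ≤ R^2 := by gcongr
      have e3 : t * ε * (2 * R^2) ≤ t * ε * (3 * R^2 - ε^2) := by gcongr; linarith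
      nlinarith
    have b := kdv_H_bound hE hR1 (z := Z R) (z' := Z (-R))
      (by simp only [Z]; rw [kdv_z_re]; linarith)
      (by simp only [Z]; rw [kdv_z_re, neg_sq]; linarith)
    refine b.trans ?_
    simp only [Z]
    rw [kdv_z_sub, norm_mul, Complex.norm_I, mul_one, Complex.norm_real, Real.norm_eq_abs]
    have : |2 * t * (R^3 - 3 * R * ε^2)| ≤ 2 * t * R^3 + 6 * t * ε^2 * R := by
      have p1 : 0 ≤ 2 * t * R^3 := by positivity
      have p2 : 0 ≤ 6 * t * ε^2 * R := by positivity
      rw [abs_le]; constructor <;> nlinarith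
    calc _ ≤ Real.exp (-R) * (2 * t * R^3 + 6 * t * ε^2 * R) := by gcongr
      _ = _ := by ring
  have t4 := t1.add ((t3.sub t2).div_const 3)
  have l2 : Tendsto (fun R : ℝ => ∫ ξ in -R..R, kdvPhi ε 0 0 t ξ) atTop
    (𝓝 (kdvG ε 0 (0,t))) := l1
  simp only [hint] at l2
  rw [tendsto_nhds_unique l2 t4]
  ring

theorem stmt6 (ε : ℝ) (hε : 0 < ε) :
    (∀ x > (0:ℝ), ∀ t > (0:ℝ), Integrable (fun ξ : ℝ =>
      Complex.exp (Complex.I * lamC ε ξ * (x:ℂ) + Complex.I * (lamC ε ξ)^3 * (t:ℂ))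
        / lamC ε ξ)) ∧
    ContDiffOn ℝ (⊤:ℕ∞) (fun p : ℝ × ℝ => kdvVeps ε p.1 p.2) (Ioi (0:ℝ) ×ˢ Ioi (0:ℝ)) ∧
    (∀ x > (0:ℝ), ∀ t > (0:ℝ),
      deriv (fun s => kdvVeps ε x s) t = -(iteratedDeriv 3 (fun y => kdvVeps ε y t) x)) ∧
    (∀ t > (0:ℝ), Tendsto (fun x => kdvVeps ε x t) (𝓝[>] (0:ℝ)) (𝓝 1)) ∧
    (∀ x > (0:ℝ), Tendsto (fun t => kdvVeps ε x t) (𝓝[>] (0:ℝ)) (𝓝 0)) := by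
  refine ⟨?_, ?_, fun x _ t ht => kdv_pde hε x ht, ?_, ?_⟩
  · intro x _ t ht
    have := kdvPhi_int hε 0 x ht
    unfold kdvPhi at this
    simpa using this
  · simp only [kdvVeps_eq]
    refine contDiffOn_const.mul ?_
    refine ContDiffOn.mono (s := {p : ℝ × ℝ | 0 < p.2}) ?_ (fun p hp => hp.2)
    exact contDiffOn_infty.2 fun n => kdvG_contDiffOn hε n 0
  · intro t ht
    simp only [kdvVeps_eq]
    have h := ((kdvG_dx hε 0 0 ht).continuousAt.tendsto.mono_left
      (nhdsWithin_le_nhds (s := Ioi 0))).const_mul (-(3 / (2 * (Real.pi : ℂ) * Complex.I)))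
    rw [kdvG_zero_val hε ht] at h
    convert h using 2
    have : (Real.pi:ℂ) ≠ 0 := by exact_mod_cast Real.pi_ne_zero
    have hI := Complex.I_ne_zero
    field_simp
  · intro x hx
    simp only [kdvVeps_eq]
    simpa using (kdvG_t_lim hε hx).const_mul (-(3 / (2 * (Real.pi : ℂ) * Complex.I)))
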